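/- Let (V, C, e) be an operator system and let p_1, …, p_N ∈ V be positive contractions. Then the family (C(p_1, …, p_N)_n)_{n≥1} is a (possibly non-proper) matrix ordering on the *-vector space M_{2^N}(V): each C(p_1, …, p_N)_n is closed under addition and multiplication by nonnegative reals; if x ∈ C(p_1, …, p_N)_n and y ∈ C(p_1, …, p_N)_m then the direct sum x ⊕ y lies in C(p_1, …, p_N)_{n+m}; and for every complex n×m matrix α and every x ∈ C(p_1, …, p_N)_n, the matrix (α ⊗ I_{2^N})* x (α ⊗ I_{2^N}) lies in C(p_1, …, p_N)_m. -/

import Mathlib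

open scoped ComplexOrder

/-- `x` is a hermitian matrix over a ∗-vector space. -/
def IsHermMat {V ι : Type} [Star V] (x : Matrix ι ι V) : Prop :=
  ∀ i j, x j i = star (x i j)

/-- A family of cones of matrices over `V`, one for each finite matrix-index type. -/
abbrev ConeFamily (V : Type) : Type 1 :=
  ∀ (ι : Type) [Fintype ι] [DecidableEq ι], Set (Matrix ι ι V)

section Core

variable {V : Type} [AddCommGroup V] [Module ℂ V] [StarAddMonoid V] [StarModule ℂ V]

/-- conjugation `α* x α` of `x ∈ M_ι(V)` by a scalar matrix `α : M_{ι,κ}(ℂ)`. -/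
def conjBy {ι κ : Type} [Fintype ι] (α : Matrix ι κ ℂ) (x : Matrix ι ι V) :
    Matrix κ κ V :=
  Matrix.of fun s t => ∑ i, ∑ j, ((starRingEnd ℂ) (α i s) * α j t) • x i j

/-- `C` is a matrix ordering on the ∗-vector space `V`. -/
structure IsMatrixOrdering (C : ConeFamily V) : Prop where
  herm_mem : ∀ (ι : Type) [Fintype ι] [DecidableEq ι], ∀ x ∈ C ι, IsHermMat x
  add_mem : ∀ (ι : Type) [Fintype ι] [DecidableEq ι], ∀ x ∈ C ι, ∀ y ∈ C ι, x + y ∈ C ι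
  smul_mem : ∀ (ι : Type) [Fintype ι] [DecidableEq ι], ∀ r : ℝ, 0 ≤ r → ∀ x ∈ C ι,
    (r : ℂ) • x ∈ C ι
  conj_mem : ∀ (ι κ : Type) [Fintype ι] [DecidableEq ι] [Fintype κ] [DecidableEq κ],
    ∀ (α : Matrix ι κ ℂ), ∀ x ∈ C ι, conjBy α x ∈ C κ

/-- the diagonal matrix `I_ι ⊗ e` with `e` in every diagonal entry. -/
def unitMat {ι : Type} [DecidableEq ι] (e : V) : Matrix ι ι V :=
  Matrix.of fun i j => if i = j then e else 0

/-- membership of an element of `V` in the ground-level cone `C_1`. -/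
def Mem1 (C : ConeFamily V) (v : V) : Prop :=
  (Matrix.of fun _ _ => v : Matrix (Fin 1) (Fin 1) V) ∈ C (Fin 1)

/-- `(V, C, e)` is an (abstract) operator system: `C` is a proper matrix ordering and
`e` is an Archimedean matrix order unit. -/
structure IsOperatorSystem (C : ConeFamily V) (e : V) extends IsMatrixOrdering C : Prop where
  proper : ∀ (ι : Type) [Fintype ι] [DecidableEq ι], ∀ x ∈ C ι, -x ∈ C ι → x = 0
  unit_mem : Mem1 C e
  orderUnit : ∀ (ι : Type) [Fintype ι] [DecidableEq ι], ∀ x : Matrix ι ι V, IsHermMat x →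
    ∃ t : ℝ, 0 < t ∧ (t : ℂ) • (unitMat e : Matrix ι ι V) - x ∈ C ι
  arch : ∀ (ι : Type) [Fintype ι] [DecidableEq ι], ∀ x : Matrix ι ι V,
    (∀ ε : ℝ, 0 < ε → x + (ε : ℂ) • (unitMat e : Matrix ι ι V) ∈ C ι) → x ∈ C ι

/-- `p` is a positive contraction: `p ∈ C_1` and `e - p ∈ C_1`. -/
def IsPosCon (C : ConeFamily V) (e p : V) : Prop :=
  Mem1 C p ∧ Mem1 C (e - p)

/-- the `2 × 2` diagonal matrix `p ⊕ q` over `V`. -/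
def diagPQ (p q : V) : Matrix (Fin 2) (Fin 2) V :=
  Matrix.of fun s t => if s = t then (if s = 0 then p else q) else 0

/-- `I_ι ⊗ y`. -/
def idKron {ι κ : Type} [DecidableEq ι] (y : Matrix κ κ V) : Matrix (ι × κ) (ι × κ) V :=
  Matrix.of fun a b => if a.1 = b.1 then y a.2 b.2 else 0

/-- `x ⊗ J_κ`, the Kronecker product of `x` with the all-ones matrix. -/
def onesKron {ι κ : Type} (x : Matrix ι ι V) : Matrix (ι × κ) (ι × κ) V :=
  Matrix.of fun a b => x a.1 b.1

/-- the cone `C(p)_ι ⊆ M_{ι × 2}(V)` associated to a positive contraction `p`. -/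
def coneP (C : ConeFamily V) (e p : V) (ι : Type) [Fintype ι] [DecidableEq ι] :
    Set (Matrix (ι × Fin 2) (ι × Fin 2) V) :=
  {x | IsHermMat x ∧ ∀ ε : ℝ, 0 < ε → ∃ t : ℝ, 0 < t ∧
    x + (ε : ℂ) • idKron (diagPQ p (e - p)) + (t : ℂ) • idKron (diagPQ (e - p) p)
      ∈ C (ι × Fin 2)}

end Core

section Multi

variable {V : Type} [AddCommGroup V] [Module ℂ V] [StarAddMonoid V] [StarModule ℂ V] {N : ℕ}

/-- `P_k^N = I_{2^{k-1}} ⊗ (p_k ⊕ p_k^⊥) ⊗ J_{2^{N-k}}` as a matrix indexed by binary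
strings of length `N` (the `j`-th bit corresponding to the `j`-th tensor factor of `2^N`). -/
def Pm (e : V) (p : Fin N → V) (k : Fin N) :
    Matrix (Fin N → Fin 2) (Fin N → Fin 2) V :=
  Matrix.of fun σ τ =>
    if (∀ j, j < k → σ j = τ j) ∧ σ k = τ k then
      (if σ k = 0 then p k else e - p k) else 0

/-- `Q_k^N = I_{2^{k-1}} ⊗ (p_k^⊥ ⊕ p_k) ⊗ J_{2^{N-k}}`. -/
def Qm (e : V) (p : Fin N → V) (k : Fin N) :
    Matrix (Fin N → Fin 2) (Fin N → Fin 2) V :=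
  Matrix.of fun σ τ =>
    if (∀ j, j < k → σ j = τ j) ∧ σ k = τ k then
      (if σ k = 0 then e - p k else p k) else 0

/-- `P̂_k^N = J_{2^{k-1}} ⊗ (p_k ⊕ p_k^⊥) ⊗ J_{2^{N-k}}`. -/
def PmHat (e : V) (p : Fin N → V) (k : Fin N) :
    Matrix (Fin N → Fin 2) (Fin N → Fin 2) V :=
  Matrix.of fun σ τ =>
    if σ k = τ k then (if σ k = 0 then p k else e - p k) else 0

/-- `Q̂_k^N = J_{2^{k-1}} ⊗ (p_k^⊥ ⊕ p_k) ⊗ J_{2^{N-k}}`. -/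
def QmHat (e : V) (p : Fin N → V) (k : Fin N) :
    Matrix (Fin N → Fin 2) (Fin N → Fin 2) V :=
  Matrix.of fun σ τ =>
    if σ k = τ k then (if σ k = 0 then e - p k else p k) else 0

/-- `x + Σ_k ε_k (I_ι ⊗ P_k^N) + Σ_k t_k (I_ι ⊗ Q_k^N) ∈ C_{ι·2^N}`. -/
def MemMulti (C : ConeFamily V) (e : V) (p : Fin N → V)
    (ι : Type) [Fintype ι] [DecidableEq ι]
    (x : Matrix (ι × (Fin N → Fin 2)) (ι × (Fin N → Fin 2)) V) (ε t : Fin N → ℝ) : Prop :=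
  x + ∑ k, (ε k : ℂ) • idKron (Pm e p k) + ∑ k, (t k : ℂ) • idKron (Qm e p k)
    ∈ C (ι × (Fin N → Fin 2))

/-- the cone `C(p_1, …, p_N)_ι ⊆ M_{ι·2^N}(V)`. -/
def coneMulti (C : ConeFamily V) (e : V) (p : Fin N → V)
    (ι : Type) [Fintype ι] [DecidableEq ι] :
    Set (Matrix (ι × (Fin N → Fin 2)) (ι × (Fin N → Fin 2)) V) :=
  {x | IsHermMat x ∧ ∀ ε : Fin N → ℝ, (∀ i, 0 < ε i) →
    ∃ t : Fin N → ℝ, (∀ i, 0 < t i) ∧ MemMulti C e p ι x ε t ∧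
      ∀ (i : Fin N) (ε' : ℝ), 0 < ε' → ε' < ε i →
        ∃ t' : ℝ, t i < t' ∧
          MemMulti C e p ι x (Function.update ε i ε') (Function.update t i t')}

/-- the `⊗J`-version of `MemMulti`, with `P̂`, `Q̂` in place of `P`, `Q`. -/
def MemMultiHat (C : ConeFamily V) (e : V) (p : Fin N → V)
    (ι : Type) [Fintype ι] [DecidableEq ι]
    (x : Matrix (ι × (Fin N → Fin 2)) (ι × (Fin N → Fin 2)) V) (ε t : Fin N → ℝ) : Prop :=
  x + ∑ k, (ε k : ℂ) • idKron (PmHat e p k) + ∑ k, (t k : ℂ) • idKron (QmHat e p k)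
    ∈ C (ι × (Fin N → Fin 2))

/-- the cone `Ĉ(p_1, …, p_N)_ι ⊆ M_{ι·2^N}(V)`. -/
def coneMultiHat (C : ConeFamily V) (e : V) (p : Fin N → V)
    (ι : Type) [Fintype ι] [DecidableEq ι] :
    Set (Matrix (ι × (Fin N → Fin 2)) (ι × (Fin N → Fin 2)) V) :=
  {x | IsHermMat x ∧ ∀ ε : Fin N → ℝ, (∀ i, 0 < ε i) →
    ∃ t : Fin N → ℝ, (∀ i, 0 < t i) ∧ MemMultiHat C e p ι x ε t ∧
      ∀ (i : Fin N) (ε' : ℝ), 0 < ε' → ε' < ε i →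
        ∃ t' : ℝ, t i < t' ∧
          MemMultiHat C e p ι x (Function.update ε i ε') (Function.update t i t')}

end Multi

section Stmt4

variable {V : Type} [AddCommGroup V] [Module ℂ V] [StarAddMonoid V] [StarModule ℂ V]

/-- the direct sum `x ⊕ y` of `x ∈ M_{ι·2^N}(V)` and `y ∈ M_{κ·2^N}(V)`,
an element of `M_{(ι⊕κ)·2^N}(V)`. -/
def dirSum {ι κ B : Type} (x : Matrix (ι × B) (ι × B) V) (y : Matrix (κ × B) (κ × B) V) :
    Matrix ((ι ⊕ κ) × B) ((ι ⊕ κ) × B) V :=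
  Matrix.of fun a b =>
    match a.1, b.1 with
    | Sum.inl i, Sum.inl j => x (i, a.2) (j, b.2)
    | Sum.inr i, Sum.inr j => y (i, a.2) (j, b.2)
    | _, _ => 0

/-- the conjugation `(α ⊗ I_B)* x (α ⊗ I_B)` of `x ∈ M_{ι·B}(V)` by a scalar matrix
`α ∈ M_{ι,κ}(ℂ)`. -/
def conjByKron {ι κ B : Type} [Fintype ι] (α : Matrix ι κ ℂ)
    (x : Matrix (ι × B) (ι × B) V) : Matrix (κ × B) (κ × B) V :=
  Matrix.of fun s t =>
    ∑ i, ∑ j, ((starRingEnd ℂ) (α i s.1) * α j t.1) • x (i, s.2) (j, t.2)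

open scoped Matrix

theorem IsMatrixOrdering.zero_mem {C : ConeFamily V} (hC : IsMatrixOrdering C) {v : V}
    (hv : Mem1 C v) (ι : Type) [Fintype ι] [DecidableEq ι] : (0 : Matrix ι ι V) ∈ C ι := by
  have h := hC.conj_mem (Fin 1) ι 0 _ hv
  convert h using 1
  ext s t
  simp [conjBy]

theorem IsMatrixOrdering.sum_mem {C : ConeFamily V} (hC : IsMatrixOrdering C) {v : V}
    (hv : Mem1 C v) {ι K : Type} [Fintype ι] [DecidableEq ι] (S : Finset K)
    (x : K → Matrix ι ι V) (hx : ∀ k ∈ S, x k ∈ C ι) : ∑ k ∈ S, x k ∈ C ι :=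
  Finset.sum_induction x (· ∈ C ι) (fun a b ha hb => hC.add_mem ι a ha b hb)
    (hC.zero_mem hv ι) hx

/-- The Kronecker product `M ⊗ y` of a scalar matrix `M` with a matrix `y` over `V`. -/
def scalarKron {κ B : Type} (M : Matrix κ κ ℂ) (y : Matrix B B V) :
    Matrix (κ × B) (κ × B) V :=
  Matrix.of fun a b => M a.1 b.1 • y a.2 b.2

open scoped MatrixOrder Matrix.Norms.L2Operator in
theorem Matrix.PosSemidef.exists_eq_conjTranspose_mul_self {κ : Type} [Fintype κ]
    [DecidableEq κ] {M : Matrix κ κ ℂ} (hM : M.PosSemidef) : ∃ β : Matrix κ κ ℂ, M = βᴴ * β :=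
  CStarAlgebra.nonneg_iff_eq_star_mul_self.mp hM.nonneg

theorem scalarKron_mem {C : ConeFamily V} (hC : IsMatrixOrdering C) {v : V} (hv : Mem1 C v)
    {κ B D : Type} [Fintype κ] [DecidableEq κ] [Fintype B] [DecidableEq B]
    [Fintype D] [DecidableEq D] {M : Matrix κ κ ℂ} (hM : M.PosSemidef)
    (f : B → D) (w : D → V) (hw : ∀ d, Mem1 C (w d)) :
    scalarKron M (Matrix.of fun σ τ : B => if f σ = f τ then w (f σ) else 0) ∈ C (κ × B) := by
  obtain ⟨β, rfl⟩ := hM.exists_eq_conjTranspose_mul_self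
  have key := hC.sum_mem hv (Finset.univ : Finset (κ × D))
    (fun q => conjBy (Matrix.of fun (_ : Fin 1) (a : κ × B) =>
      if f a.2 = q.2 then β q.1 a.1 else 0) (Matrix.of fun _ _ => w q.2))
    (fun q _ => hC.conj_mem _ _ _ _ (hw q.2))
  convert key using 1
  ext ⟨s, σ⟩ ⟨t, τ⟩
  rw [Matrix.sum_apply, Fintype.sum_prod_type]
  simp only [conjBy, scalarKron, Matrix.of_apply, Matrix.mul_apply, Matrix.conjTranspose_apply,
    Finset.univ_unique, Finset.sum_singleton, Finset.sum_smul]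
  refine Finset.sum_congr rfl fun r _ => ?_
  rw [Finset.sum_eq_single (f σ)]
  · by_cases h : f σ = f τ
    · simp [h]
    · simp [h, Ne.symm h]
  · intro d _ hd
    simp [Ne.symm hd]
  · simp

/-- The prefix of `σ` through position `k`, padded by zeros. -/
def bitPrefix {N : ℕ} (k : Fin N) (σ : Fin N → Fin 2) : Fin N → Fin 2 :=
  fun j => if j ≤ k then σ j else 0

theorem bitPrefix_eq_iff {N : ℕ} (k : Fin N) (σ τ : Fin N → Fin 2) :
    bitPrefix k σ = bitPrefix k τ ↔ (∀ j, j < k → σ j = τ j) ∧ σ k = τ k := by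
  constructor
  · intro h
    refine ⟨fun j hj => ?_, ?_⟩
    · simpa [bitPrefix, hj.le] using congrFun h j
    · simpa [bitPrefix] using congrFun h k
  · rintro ⟨h, hk⟩
    ext j
    rcases lt_trichotomy j k with hj | rfl | hj
    · simp [bitPrefix, hj.le, h j hj]
    · simp [bitPrefix, hk]
    · simp [bitPrefix, hj.not_ge]

theorem scalarKron_Pm_mem {C : ConeFamily V} (hC : IsMatrixOrdering C) {e : V} {N : ℕ}
    {p : Fin N → V} (hp : ∀ i, IsPosCon C e (p i)) (k : Fin N)
    {κ : Type} [Fintype κ] [DecidableEq κ] {M : Matrix κ κ ℂ} (hM : M.PosSemidef) :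
    scalarKron M (Pm e p k) ∈ C (κ × (Fin N → Fin 2)) := by
  convert scalarKron_mem hC (hp k).1 hM (bitPrefix k)
    (fun d => if d k = 0 then p k else e - p k)
    (fun d => by split_ifs; exacts [(hp k).1, (hp k).2]) using 2
  ext σ τ
  simp only [Pm, Matrix.of_apply, bitPrefix_eq_iff]
  simp [bitPrefix]

theorem scalarKron_Qm_mem {C : ConeFamily V} (hC : IsMatrixOrdering C) {e : V} {N : ℕ}
    {p : Fin N → V} (hp : ∀ i, IsPosCon C e (p i)) (k : Fin N)
    {κ : Type} [Fintype κ] [DecidableEq κ] {M : Matrix κ κ ℂ} (hM : M.PosSemidef) :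
    scalarKron M (Qm e p k) ∈ C (κ × (Fin N → Fin 2)) := by
  convert scalarKron_mem hC (hp k).1 hM (bitPrefix k)
    (fun d => if d k = 0 then e - p k else p k)
    (fun d => by split_ifs; exacts [(hp k).2, (hp k).1]) using 2
  ext σ τ
  simp only [Qm, Matrix.of_apply, bitPrefix_eq_iff]
  simp [bitPrefix]

/-- `conjByKron α` as a linear map. -/
def conjByKronLinear {ι κ B : Type} [Fintype ι] (α : Matrix ι κ ℂ) :
    Matrix (ι × B) (ι × B) V →ₗ[ℂ] Matrix (κ × B) (κ × B) V where
  toFun := conjByKron α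
  map_add' x y := by
    ext s t
    simp [conjByKron, Finset.sum_add_distrib]
  map_smul' r x := by
    ext s t
    simp only [conjByKron, Matrix.of_apply, Matrix.smul_apply, RingHom.id_apply,
      Finset.smul_sum]
    exact Finset.sum_congr rfl fun i _ => Finset.sum_congr rfl fun j _ => smul_comm _ _ _

theorem conjByKron_mem {C : ConeFamily V} (hC : IsMatrixOrdering C)
    {ι κ B : Type} [Fintype ι] [DecidableEq ι] [Fintype κ] [DecidableEq κ]
    [Fintype B] [DecidableEq B] (α : Matrix ι κ ℂ) {x : Matrix (ι × B) (ι × B) V}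
    (hx : x ∈ C (ι × B)) : conjByKron α x ∈ C (κ × B) := by
  convert hC.conj_mem _ (κ × B) (Matrix.of fun (a : ι × B) (b : κ × B) =>
    if a.2 = b.2 then α a.1 b.1 else 0) x hx using 1
  ext s t
  simp [conjBy, conjByKron, Fintype.sum_prod_type, apply_ite, ite_smul]

theorem conjByKron_idKron {ι κ B : Type} [Fintype ι] [DecidableEq ι] (α : Matrix ι κ ℂ)
    (y : Matrix B B V) : conjByKron α (idKron y) = scalarKron (αᴴ * α) y := by
  ext s t
  simp [conjByKron, idKron, scalarKron, Matrix.mul_apply, Finset.sum_smul]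

theorem scalarKron_smul_one_sub {κ B : Type} [DecidableEq κ] (c : ℂ) (M : Matrix κ κ ℂ)
    (y : Matrix B B V) :
    scalarKron (c • 1 - M) y = c • idKron y - scalarKron M y := by
  ext s t
  by_cases h : s.1 = t.1 <;> simp [scalarKron, idKron, Matrix.one_apply, h, sub_smul]

theorem isHermMat_conjByKron {ι κ B : Type} [Fintype ι] (α : Matrix ι κ ℂ)
    {x : Matrix (ι × B) (ι × B) V} (hx : IsHermMat x) : IsHermMat (conjByKron α x) := by
  intro s t
  simp only [conjByKron, Matrix.of_apply, star_sum, star_smul]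
  rw [Finset.sum_comm]
  refine Finset.sum_congr rfl fun i _ => Finset.sum_congr rfl fun j _ => ?_
  rw [hx]
  simp [mul_comm]

open scoped MatrixOrder Matrix.Norms.L2Operator in
theorem exists_posSemidef_smul_one_sub {κ : Type} [Fintype κ] [DecidableEq κ]
    {M : Matrix κ κ ℂ} (hM : M.IsHermitian) :
    ∃ c : ℝ, 0 < c ∧ ((c : ℂ) • (1 : Matrix κ κ ℂ) - M).PosSemidef := by
  refine ⟨‖M‖ + 1, by positivity, ?_⟩
  have h : M ≤ algebraMap ℝ (Matrix κ κ ℂ) ‖M‖ :=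
    IsSelfAdjoint.le_algebraMap_norm_self (a := M) hM
  have h2 := (Matrix.le_iff.1 h).add Matrix.PosSemidef.one
  have heq : ((‖M‖ + 1 : ℝ) : ℂ) • (1 : Matrix κ κ ℂ) - M =
      algebraMap ℝ (Matrix κ κ ℂ) ‖M‖ - M + 1 := by
    rw [Algebra.algebraMap_eq_smul_one]
    ext i j
    simp
    ring
  rw [heq]
  exact h2

theorem MemMulti.add {C : ConeFamily V} (hC : IsMatrixOrdering C) {e : V} {N : ℕ}
    {p : Fin N → V} {ι : Type} [Fintype ι] [DecidableEq ι]
    {x y : Matrix (ι × (Fin N → Fin 2)) (ι × (Fin N → Fin 2)) V} {ε t ε' t' : Fin N → ℝ}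
    (hx : MemMulti C e p ι x ε t) (hy : MemMulti C e p ι y ε' t') :
    MemMulti C e p ι (x + y) (ε + ε') (t + t') := by
  have h := hC.add_mem _ _ hx _ hy
  unfold MemMulti
  convert h using 1
  simp only [Pi.add_apply, Complex.ofReal_add, add_smul, Finset.sum_add_distrib]
  abel

theorem MemMulti.conjByKron {C : ConeFamily V} (hC : IsMatrixOrdering C) {e : V} (he : Mem1 C e)
    {N : ℕ} {p : Fin N → V} (hp : ∀ i, IsPosCon C e (p i))
    {ι κ : Type} [Fintype ι] [DecidableEq ι] [Fintype κ] [DecidableEq κ]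
    {x : Matrix (ι × (Fin N → Fin 2)) (ι × (Fin N → Fin 2)) V} {ε t : Fin N → ℝ}
    (hε : ∀ i, 0 < ε i) (ht : ∀ i, 0 < t i) {α : Matrix ι κ ℂ} {c : ℝ}
    (hα : ((c : ℂ) • (1 : Matrix κ κ ℂ) - αᴴ * α).PosSemidef)
    (hx : MemMulti C e p ι x ε t) :
    MemMulti C e p κ (conjByKron α x) (c • ε) (c • t) := by
  have hP := hC.sum_mem he Finset.univ _ fun k _ =>
    hC.smul_mem _ _ (hε k).le _ (scalarKron_Pm_mem hC hp k hα)
  have hQ := hC.sum_mem he Finset.univ _ fun k _ =>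
    hC.smul_mem _ _ (ht k).le _ (scalarKron_Qm_mem hC hp k hα)
  have h := hC.add_mem _ _ (hC.add_mem _ _ (conjByKron_mem hC α hx) _ hP) _ hQ
  unfold MemMulti
  convert h using 1
  change _ = conjByKronLinear α _ + _ + _
  simp only [map_add, map_sum, map_smul, scalarKron_smul_one_sub, smul_sub,
    Finset.sum_sub_distrib]
  change _ = _root_.conjByKron α x + ∑ k, (ε k : ℂ) • _root_.conjByKron α (idKron (Pm e p k)) +
    ∑ k, (t k : ℂ) • _root_.conjByKron α (idKron (Qm e p k)) + _ + _
  simp only [conjByKron_idKron, Pi.smul_apply, smul_eq_mul, Complex.ofReal_mul, mul_smul,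
    smul_comm (_ : ℂ) (c : ℂ)]
  abel

theorem coneMulti_add_mem {C : ConeFamily V} (hC : IsMatrixOrdering C) (e : V) {N : ℕ}
    (p : Fin N → V) {ι : Type} [Fintype ι] [DecidableEq ι]
    {x y : Matrix (ι × (Fin N → Fin 2)) (ι × (Fin N → Fin 2)) V}
    (hx : x ∈ coneMulti C e p ι) (hy : y ∈ coneMulti C e p ι) :
    x + y ∈ coneMulti C e p ι := by
  refine ⟨fun i j => by simp [hx.1 i j, hy.1 i j], fun ε hε => ?_⟩
  have hε2 : ∀ i, 0 < (fun i => ε i / 2) i := fun i => half_pos (hε i)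
  obtain ⟨t, ht, hxt, hx'⟩ := hx.2 _ hε2
  obtain ⟨u, hu, hyu, hy'⟩ := hy.2 _ hε2
  refine ⟨t + u, fun i => add_pos (ht i) (hu i), ?_, fun i ε' h0 h1 => ?_⟩
  · convert hxt.add hC hyu using 1
    ext i
    simp
  · obtain ⟨t', ht', hxt'⟩ := hx' i (ε' / 2) (half_pos h0) (by simpa using by linarith)
    obtain ⟨u', hu', hyu'⟩ := hy' i (ε' / 2) (half_pos h0) (by simpa using by linarith)
    refine ⟨t' + u', add_lt_add ht' hu', ?_⟩
    convert hxt'.add hC hyu' using 1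
    · rw [← Function.update_add, add_halves]
      congr 1
      ext j
      simp
    · rw [← Function.update_add]

theorem coneMulti_conjByKron_mem {C : ConeFamily V} (hC : IsMatrixOrdering C) {e : V}
    (he : Mem1 C e) {N : ℕ} {p : Fin N → V} (hp : ∀ i, IsPosCon C e (p i))
    {ι κ : Type} [Fintype ι] [DecidableEq ι] [Fintype κ] [DecidableEq κ] (α : Matrix ι κ ℂ)
    {x : Matrix (ι × (Fin N → Fin 2)) (ι × (Fin N → Fin 2)) V}
    (hx : x ∈ coneMulti C e p ι) : conjByKron α x ∈ coneMulti C e p κ := by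
  obtain ⟨c, hc, hα⟩ := exists_posSemidef_smul_one_sub (Matrix.isHermitian_conjTranspose_mul_self α)
  refine ⟨isHermMat_conjByKron α hx.1, fun ε hε => ?_⟩
  have hεc : ∀ i, 0 < (c⁻¹ • ε) i := fun i => mul_pos (inv_pos.2 hc) (hε i)
  obtain ⟨t, ht, hxt, hx'⟩ := hx.2 _ hεc
  refine ⟨c • t, fun i => mul_pos hc (ht i), ?_, fun i ε' h0 h1 => ?_⟩
  · simpa [smul_smul, hc.ne'] using hxt.conjByKron hC he hp hεc ht hα
  · have h0c : 0 < c⁻¹ * ε' := mul_pos (inv_pos.2 hc) h0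
    obtain ⟨t', ht', hxt'⟩ := hx' i (c⁻¹ * ε') h0c (mul_lt_mul_of_pos_left h1 (inv_pos.2 hc))
    refine ⟨c * t', mul_lt_mul_of_pos_left ht' hc, ?_⟩
    have hpos : ∀ {f : Fin N → ℝ} {a : ℝ}, (∀ j, 0 < f j) → 0 < a →
        ∀ j, 0 < Function.update f i a j := by
      intro f a hf ha j
      by_cases hj : j = i
      · subst hj
        simpa using ha
      · simpa [hj] using hf j
    have h := hxt'.conjByKron hC he hp (hpos hεc h0c) (hpos ht ((ht i).trans ht')) hα
    rw [← Function.update_smul, ← Function.update_smul] at h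
    simpa [smul_smul, hc.ne'] using h

theorem dirSum_eq_conjByKron_add {ι κ B : Type} [Fintype ι] [DecidableEq ι] [Fintype κ]
    [DecidableEq κ] (x : Matrix (ι × B) (ι × B) V) (y : Matrix (κ × B) (κ × B) V) :
    dirSum x y = conjByKron (Matrix.fromCols 1 0 : Matrix ι (ι ⊕ κ) ℂ) x +
      conjByKron (Matrix.fromCols 0 1 : Matrix κ (ι ⊕ κ) ℂ) y := by
  ext ⟨s | s, σ⟩ ⟨t | t, τ⟩ <;>
    simp [dirSum, conjByKron, Matrix.one_apply, apply_ite, ite_smul]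

theorem conjByKron_sqrt_smul_one {ι B : Type} [Fintype ι] [DecidableEq ι] {r : ℝ} (hr : 0 ≤ r)
    (x : Matrix (ι × B) (ι × B) V) :
    conjByKron ((√r : ℂ) • (1 : Matrix ι ι ℂ)) x = (r : ℂ) • x := by
  have h : (√r : ℂ) * √r = r := by exact_mod_cast Real.mul_self_sqrt hr
  ext s t
  simp [conjByKron, Matrix.one_apply, apply_ite, ite_smul, h]

/-- `C(p_1, …, p_N)` is a (possibly non-proper) matrix ordering on
`M_{2^N}(V)`. -/
theorem stmt_4 (C : ConeFamily V) (e : V) (hos : IsOperatorSystem C e)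
    {N : ℕ} (hN : 1 ≤ N) (p : Fin N → V) (hp : ∀ i, IsPosCon C e (p i)) :
    (∀ (ι : Type) [Fintype ι] [DecidableEq ι],
      ∀ x ∈ coneMulti C e p ι, ∀ y ∈ coneMulti C e p ι, x + y ∈ coneMulti C e p ι) ∧
    (∀ (ι : Type) [Fintype ι] [DecidableEq ι], ∀ r : ℝ, 0 ≤ r →
      ∀ x ∈ coneMulti C e p ι, (r : ℂ) • x ∈ coneMulti C e p ι) ∧
    (∀ (ι κ : Type) [Fintype ι] [DecidableEq ι] [Fintype κ] [DecidableEq κ],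
      ∀ x ∈ coneMulti C e p ι, ∀ y ∈ coneMulti C e p κ,
        dirSum x y ∈ coneMulti C e p (ι ⊕ κ)) ∧
    (∀ (ι κ : Type) [Fintype ι] [DecidableEq ι] [Fintype κ] [DecidableEq κ],
      ∀ (α : Matrix ι κ ℂ), ∀ x ∈ coneMulti C e p ι,
        conjByKron α x ∈ coneMulti C e p κ) := by
  have hC := hos.toIsMatrixOrdering
  have hconj : ∀ (ι κ : Type) [Fintype ι] [DecidableEq ι] [Fintype κ] [DecidableEq κ],
      ∀ (α : Matrix ι κ ℂ), ∀ x ∈ coneMulti C e p ι, conjByKron α x ∈ coneMulti C e p κ :=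
    fun _ _ _ _ _ _ α _ hx => coneMulti_conjByKron_mem hC hos.unit_mem hp α hx
  refine ⟨fun _ _ _ _ hx _ hy => coneMulti_add_mem hC e p hx hy, ?_, ?_, hconj⟩
  · intro ι _ _ r hr x hx
    rw [← conjByKron_sqrt_smul_one hr x]
    exact hconj _ _ _ _ hx
  · intro ι κ _ _ _ _ x hx y hy
    rw [dirSum_eq_conjByKron_add]
    exact coneMulti_add_mem hC e p (hconj _ _ _ _ hx) (hconj _ _ _ _ hy)

end Stmt4
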